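/- arXiv:0905.2089 — 2 statements merged into one kernel-verified Lean document; each statement's English description precedes it below -/
import Mathlib

section
/- The semicircle density ρ_sc(x) = (1/(2π))√(4−x²)·1_{[−2,2]}(x) satisfies (1/2)∫ x² ρ_sc(x) dx − ∫∫ log|x−y| ρ_sc(x) ρ_sc(y) dx dy = 3/4. -/
open MeasureTheory

/-- The Wigner semicircle density. -/
noncomputable def rhoSC (x : ℝ) : ℝ :=
  if |x| ≤ 2 then Real.sqrt (4 - x ^ 2) / (2 * Real.pi) else 0

noncomputable def lgH (u : ℝ) : ℝ := Real.log (2 * Real.sin (u / 2))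

lemma lgH_neg (u : ℝ) : lgH (-u) = lgH u := by
  unfold lgH
  rw [neg_div, Real.sin_neg, mul_neg, Real.log_neg_eq_log]

lemma lgH_periodic : Function.Periodic lgH (2 * Real.pi) := by
  intro u
  unfold lgH
  rw [show (u + 2 * Real.pi) / 2 = u / 2 + Real.pi by ring, Real.sin_add_pi, mul_neg,
    Real.log_neg_eq_log]

lemma lg_int (a b : ℝ) :
    IntervalIntegrable (fun t => Real.log (2 * Real.sin t)) volume a b := by
  have h : MeromorphicOn (fun t : ℝ => 2 * Real.sin t) (Set.uIcc a b) := by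
    apply AnalyticOnNhd.meromorphicOn
    intro x _
    fun_prop
  exact h.intervalIntegrable_log

lemma lgH_int (φ a b : ℝ) : IntervalIntegrable (fun u => lgH (u + φ)) volume a b := by
  have h : MeromorphicOn (fun t : ℝ => 2 * Real.sin ((t + φ) / 2)) (Set.uIcc a b) := by
    apply AnalyticOnNhd.meromorphicOn
    intro x _
    have h1 : AnalyticAt ℝ (fun t : ℝ => (t + φ) / 2) x := by fun_prop
    have h2 : AnalyticAt ℝ Real.sin ((x + φ) / 2) := by fun_prop
    exact analyticAt_const.mul (AnalyticAt.comp (g := Real.sin) (f := fun t : ℝ => (t + φ) / 2) h2 h1)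
  exact h.intervalIntegrable_log

lemma ae_ne' (c : ℝ) : ∀ᵐ x : ℝ, x ≠ c := by
  have h := (Set.finite_singleton c).measure_zero volume
  exact measure_eq_zero_iff_ae_notMem.mp h

lemma int_lg : ∫ t in (0 : ℝ)..Real.pi, Real.log (2 * Real.sin t) = 0 := by
  have h : ∫ t in (0 : ℝ)..Real.pi, Real.log (2 * Real.sin t)
      = ∫ t in (0 : ℝ)..Real.pi, (Real.log 2 + Real.log (Real.sin t)) := by
    apply intervalIntegral.integral_congr_ae
    filter_upwards [ae_ne' Real.pi] with t ht hm
    rw [Set.uIoc_of_le Real.pi_pos.le] at hm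
    have := Real.sin_pos_of_pos_of_lt_pi hm.1 (lt_of_le_of_ne hm.2 ht)
    rw [Real.log_mul two_ne_zero this.ne']
  rw [h, intervalIntegral.integral_add intervalIntegrable_const
    (by exact intervalIntegrable_log_sin), integral_log_sin_zero_pi]
  simp
  ring

lemma sin4 (t : ℝ) : Real.sin (4 * t) = 4 * Real.sin t * Real.cos t * Real.cos (2 * t) := by
  rw [show 4 * t = 2 * (2 * t) by ring, Real.sin_two_mul, Real.sin_two_mul]; ring

lemma int_lg_cos :
    ∫ t in (0 : ℝ)..Real.pi, Real.log (2 * Real.sin t) * Real.cos (4 * t) = -Real.pi / 4 := by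
  have key := intervalIntegral.integral_eq_sub_of_hasDerivAt_of_le
    (f := fun t => Real.log (2 * Real.sin t) * (Real.sin (4 * t) / 4)
      - (Real.sin (2 * t) / 4 + t / 4 + Real.sin (4 * t) / 16))
    (f' := fun t => Real.log (2 * Real.sin t) * Real.cos (4 * t)) Real.pi_pos.le ?_ ?_ ?_
  · rw [key]
    have h4 : Real.sin (4 * Real.pi) = 0 := by
      simpa using Real.sin_nat_mul_pi 4
    simp [h4]
    ring
  · have : (fun t => Real.log (2 * Real.sin t) * (Real.sin (4 * t) / 4)
      - (Real.sin (2 * t) / 4 + t / 4 + Real.sin (4 * t) / 16)) =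
      (fun t => ((2 * Real.sin t) * Real.log (2 * Real.sin t)) *
          (Real.cos t * Real.cos (2 * t) / 2)
      - (Real.sin (2 * t) / 4 + t / 4 + Real.sin (4 * t) / 16)) := by
      funext t
      rw [sin4]; ring
    rw [this]
    apply Continuous.continuousOn
    have h1 : Continuous fun t : ℝ => (2 * Real.sin t) * Real.log (2 * Real.sin t) :=
      Real.continuous_mul_log.comp (by fun_prop : Continuous fun t : ℝ => 2 * Real.sin t)
    fun_prop
  · intro t ht
    have hs := Real.sin_pos_of_pos_of_lt_pi ht.1 ht.2
    have d4 : HasDerivAt (fun t : ℝ => Real.sin (4 * t)) (Real.cos (4 * t) * (4 * 1)) t :=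
      ((hasDerivAt_id t).const_mul 4).sin
    have d2 : HasDerivAt (fun t : ℝ => Real.sin (2 * t)) (Real.cos (2 * t) * (2 * 1)) t :=
      ((hasDerivAt_id t).const_mul 2).sin
    have dl := ((Real.hasDerivAt_sin t).const_mul 2).log (by positivity)
    have := (dl.mul (d4.div_const 4)).sub
      (((d2.div_const 4).add ((hasDerivAt_id t).div_const 4)).add (d4.div_const 16))
    refine this.congr_deriv ?_
    rw [sin4]
    have e4 : Real.cos (4 * t) = 2 * Real.cos (2 * t) ^ 2 - 1 := by
      rw [show 4 * t = 2 * (2 * t) by ring, Real.cos_two_mul]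
    have e2 := Real.cos_two_mul t
    field_simp
    rw [e4, e2]
    ring
  · exact (lg_int _ _).mul_continuousOn (by fun_prop)

lemma int_H : ∫ u in (-Real.pi)..Real.pi, lgH u = 0 := by
  have h := lgH_periodic.intervalIntegral_add_eq (-Real.pi) 0
  rw [show -Real.pi + 2 * Real.pi = Real.pi by ring, zero_add] at h
  rw [h]
  have := intervalIntegral.integral_comp_div (a := 0) (b := 2 * Real.pi)
    (fun s => Real.log (2 * Real.sin s)) (two_ne_zero (α := ℝ))
  unfold lgH
  rw [this, zero_div, mul_div_cancel_left₀ _ two_ne_zero, int_lg, smul_zero]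

lemma int_H_cos : ∫ u in (-Real.pi)..Real.pi, lgH u * Real.cos (2 * u) = -Real.pi / 2 := by
  have hp : Function.Periodic (fun u => lgH u * Real.cos (2 * u)) (2 * Real.pi) := by
    intro u
    have : Real.cos (2 * (u + 2 * Real.pi)) = Real.cos (2 * u) := by
      rw [show 2 * (u + 2 * Real.pi) = 2 * u + (2 : ℕ) * (2 * Real.pi) by push_cast; ring,
        Real.cos_add_nat_mul_two_pi]
    simp only [this, lgH_periodic u]
  have h := hp.intervalIntegral_add_eq (-Real.pi) 0
  rw [show -Real.pi + 2 * Real.pi = Real.pi by ring, zero_add] at h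
  rw [h]
  have := intervalIntegral.integral_comp_div (a := 0) (b := 2 * Real.pi)
    (fun s => Real.log (2 * Real.sin s) * Real.cos (4 * s)) (two_ne_zero (α := ℝ))
  rw [zero_div, mul_div_cancel_left₀ _ two_ne_zero, int_lg_cos] at this
  unfold lgH
  rw [show -Real.pi / 2 = (2 : ℝ) • (-Real.pi / 4) by simp; ring, ← this]
  congr 1
  funext u
  rw [show 4 * (u / 2) = 2 * u by ring]

lemma int_H_sin : ∫ u in (-Real.pi)..Real.pi, lgH u * Real.sin (2 * u) = 0 := by
  have h := intervalIntegral.integral_comp_neg (a := -Real.pi) (b := Real.pi)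
    (fun u => lgH u * Real.sin (2 * u))
  simp only [lgH_neg, mul_neg, Real.sin_neg, neg_neg, intervalIntegral.integral_neg] at h
  linarith

/-- shifted integral -/
lemma int_shift (φ : ℝ) :
    ∫ θ in (-Real.pi)..Real.pi, lgH (θ + φ) * (1 - Real.cos (2 * θ))
      = Real.pi / 2 * Real.cos (2 * φ) := by
  have hp : Function.Periodic (fun u => lgH u * (1 - Real.cos (2 * (u - φ)))) (2 * Real.pi) := by
    intro u
    have : Real.cos (2 * (u + 2 * Real.pi - φ)) = Real.cos (2 * (u - φ)) := by
      rw [show 2 * (u + 2 * Real.pi - φ) = 2 * (u - φ) + (2 : ℕ) * (2 * Real.pi) by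
        push_cast; ring, Real.cos_add_nat_mul_two_pi]
    simp only [this, lgH_periodic u]
  have h1 := intervalIntegral.integral_comp_add_right (a := -Real.pi) (b := Real.pi)
    (fun u => lgH u * (1 - Real.cos (2 * (u - φ)))) φ
  simp only [add_sub_cancel_right] at h1
  rw [h1]
  have h := hp.intervalIntegral_add_eq (-Real.pi + φ) (-Real.pi)
  rw [show -Real.pi + φ + 2 * Real.pi = Real.pi + φ by ring,
    show -Real.pi + 2 * Real.pi = Real.pi by ring] at h
  rw [h]
  have e : ∀ u, lgH u * (1 - Real.cos (2 * (u - φ))) = lgH u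
      - Real.cos (2 * φ) * (lgH u * Real.cos (2 * u))
      - Real.sin (2 * φ) * (lgH u * Real.sin (2 * u)) := by
    intro u
    rw [mul_sub 2 u φ, Real.cos_sub]; ring
  have i0 : IntervalIntegrable lgH volume (-Real.pi) Real.pi := by
    simpa using lgH_int 0 (-Real.pi) Real.pi
  have i1 : IntervalIntegrable (fun u => Real.cos (2 * φ) * (lgH u * Real.cos (2 * u)))
      volume (-Real.pi) Real.pi := (i0.mul_continuousOn (by fun_prop)).const_mul _
  have i2 : IntervalIntegrable (fun u => Real.sin (2 * φ) * (lgH u * Real.sin (2 * u)))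
      volume (-Real.pi) Real.pi := (i0.mul_continuousOn (by fun_prop)).const_mul _
  simp only [e]
  rw [intervalIntegral.integral_sub (i0.sub i1) i2, intervalIntegral.integral_sub i0 i1,
    intervalIntegral.integral_const_mul, intervalIntegral.integral_const_mul,
    int_H, int_H_cos, int_H_sin]
  ring

lemma log_split {φ θ : ℝ} (hφ : φ ∈ Set.Icc 0 Real.pi) (hθ : θ ∈ Set.Icc 0 Real.pi)
    (hne : θ ≠ φ) :
    Real.log |2 * Real.cos φ - 2 * Real.cos θ| = lgH (θ + φ) + lgH (θ - φ) := by
  have hc : Real.cos φ - Real.cos θ ≠ 0 := fun h =>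
    hne (Real.injOn_cos hθ hφ (by linarith))
  have e : 2 * Real.cos φ - 2 * Real.cos θ =
      (2 * Real.sin ((θ + φ) / 2)) * (2 * Real.sin ((θ - φ) / 2)) := by
    rw [← mul_sub, Real.cos_sub_cos, show (φ - θ) / 2 = -((θ - φ) / 2) by ring, Real.sin_neg,
      add_comm φ θ]
    ring
  have hc2 : 2 * Real.cos φ - 2 * Real.cos θ ≠ 0 := by
    intro h; apply hc; linarith
  rw [e] at hc2 ⊢
  rw [Real.log_abs, Real.log_mul (left_ne_zero_of_mul hc2) (right_ne_zero_of_mul hc2)]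
  rfl

lemma int_log_theta {φ : ℝ} (hφ : φ ∈ Set.Icc 0 Real.pi) :
    ∫ θ in (0 : ℝ)..Real.pi,
      Real.log |2 * Real.cos φ - 2 * Real.cos θ| * (1 - Real.cos (2 * θ))
      = Real.pi / 2 * Real.cos (2 * φ) := by
  have ii : ∀ ψ a b : ℝ, IntervalIntegrable
      (fun θ => lgH (θ + ψ) * (1 - Real.cos (2 * θ))) volume a b := fun ψ a b =>
    (lgH_int ψ a b).mul_continuousOn (by fun_prop)
  have h1 : ∫ θ in (0 : ℝ)..Real.pi,
      Real.log |2 * Real.cos φ - 2 * Real.cos θ| * (1 - Real.cos (2 * θ))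
      = ∫ θ in (0 : ℝ)..Real.pi, (lgH (θ + φ) * (1 - Real.cos (2 * θ))
        + lgH (θ + -φ) * (1 - Real.cos (2 * θ))) := by
    apply intervalIntegral.integral_congr_ae
    filter_upwards [ae_ne' φ] with θ hne hm
    rw [Set.uIoc_of_le Real.pi_pos.le] at hm
    rw [log_split hφ ⟨hm.1.le, hm.2⟩ hne, add_mul, sub_eq_add_neg θ φ]
  have h2 : ∫ θ in (0 : ℝ)..Real.pi, lgH (θ + -φ) * (1 - Real.cos (2 * θ))
      = ∫ θ in (-Real.pi)..0, lgH (θ + φ) * (1 - Real.cos (2 * θ)) := by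
    have h := intervalIntegral.integral_comp_neg (a := 0) (b := Real.pi)
      (fun θ => lgH (θ + φ) * (1 - Real.cos (2 * θ)))
    rw [neg_zero] at h
    rw [← h]
    congr 1
    funext θ
    rw [mul_neg, Real.cos_neg, ← lgH_neg (-θ + φ)]
    congr 2
    ring
  rw [h1, intervalIntegral.integral_add (ii _ _ _) (ii _ _ _), h2, add_comm,
    intervalIntegral.integral_add_adjacent_intervals (ii _ _ _) (ii _ _ _), int_shift]

lemma int_rho (f : ℝ → ℝ) : ∫ y, f y * rhoSC y
    = (1 / Real.pi) * ∫ θ in (0 : ℝ)..Real.pi, f (2 * Real.cos θ) * (1 - Real.cos (2 * θ)) := by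
  have himg : (fun θ => 2 * Real.cos θ) '' Set.Icc 0 Real.pi = Set.Icc (-2) 2 := by
    have := Real.bijOn_cos.image_eq
    rw [show (fun θ => 2 * Real.cos θ) = (fun x : ℝ => 2 * x) ∘ Real.cos from rfl,
      Set.image_comp, this, Set.image_mul_left_Icc (by norm_num) (by norm_num)]
    norm_num
  have h0 : ∫ y, f y * rhoSC y = ∫ y in Set.Icc (-2) 2, f y * rhoSC y := by
    symm
    apply setIntegral_eq_integral_of_forall_compl_eq_zero
    intro x hx
    have : ¬ |x| ≤ 2 := fun h => hx (abs_le.mp h)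
    simp [rhoSC, this]
  rw [h0, ← himg, integral_image_eq_integral_abs_deriv_smul measurableSet_Icc
    (f' := fun θ => 2 * (-Real.sin θ))
    (fun x _ => ((Real.hasDerivAt_cos x).const_mul 2).hasDerivWithinAt)
    (fun a ha b hb h => Real.injOn_cos ha hb (by simpa using h)),
    intervalIntegral.integral_of_le Real.pi_pos.le, ← integral_Icc_eq_integral_Ioc,
    ← integral_const_mul]
  apply setIntegral_congr_fun measurableSet_Icc
  intro θ hθ
  have hs := Real.sin_nonneg_of_mem_Icc hθ
  have h1 : |2 * Real.cos θ| ≤ 2 := by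
    rw [abs_mul, abs_two]; linarith [Real.abs_cos_le_one θ]
  have h2 : Real.sqrt (4 - (2 * Real.cos θ) ^ 2) = 2 * Real.sin θ := by
    rw [show 4 - (2 * Real.cos θ) ^ 2 = (2 * Real.sin θ) ^ 2 by
      rw [mul_pow, mul_pow, Real.sin_sq]; ring]
    exact Real.sqrt_sq (by positivity)
  have h3 : |2 * (-Real.sin θ)| = 2 * Real.sin θ := by
    rw [mul_neg, abs_neg, abs_of_nonneg (by positivity)]
  simp only [smul_eq_mul, rhoSC, if_pos h1, h2, h3]
  rw [Real.cos_two_mul, Real.cos_sq']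
  field_simp
  ring

lemma potential {x : ℝ} (hx : |x| ≤ 2) :
    ∫ y, Real.log |x - y| * rhoSC y = x ^ 2 / 4 - 1 / 2 := by
  have hx' := abs_le.mp hx
  have h1 : x = 2 * Real.cos (Real.arccos (x / 2)) := by
    rw [Real.cos_arccos (by linarith) (by linarith)]; ring
  generalize hφ : Real.arccos (x / 2) = φ at h1
  have hm : φ ∈ Set.Icc 0 Real.pi := hφ ▸ ⟨Real.arccos_nonneg _, Real.arccos_le_pi _⟩
  rw [h1, int_rho (fun y => Real.log |2 * Real.cos φ - y|), int_log_theta hm, Real.cos_two_mul]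
  have := Real.pi_ne_zero
  field_simp
  ring

lemma int_cos_mul (k : ℝ) (hk : k ≠ 0) : ∫ θ in (0 : ℝ)..Real.pi, Real.cos (k * θ)
    = Real.sin (k * Real.pi) / k := by
  rw [intervalIntegral.integral_comp_mul_left (fun u => Real.cos u) hk, integral_cos]
  simp
  ring

lemma int_c2 : ∫ θ in (0 : ℝ)..Real.pi, Real.cos (2 * θ) = 0 := by
  rw [int_cos_mul 2 two_ne_zero]; simp

lemma int_c4 : ∫ θ in (0 : ℝ)..Real.pi, Real.cos (4 * θ) = 0 := by
  rw [int_cos_mul 4 four_ne_zero]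
  have h4 : Real.sin (4 * Real.pi) = 0 := by simpa using Real.sin_nat_mul_pi 4
  simp [h4]

lemma mass : ∫ y, rhoSC y = 1 := by
  have h := int_rho (fun _ => 1)
  simp only [one_mul] at h
  rw [h, intervalIntegral.integral_sub (Continuous.intervalIntegrable (by fun_prop) _ _)
    (Continuous.intervalIntegrable (by fun_prop) _ _), int_c2]
  simp

lemma second : ∫ y, y ^ 2 * rhoSC y = 1 := by
  rw [int_rho (fun y => y ^ 2)]
  have e : ∀ θ : ℝ, (2 * Real.cos θ) ^ 2 * (1 - Real.cos (2 * θ)) = 1 - Real.cos (4 * θ) := by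
    intro θ
    rw [show 4 * θ = 2 * (2 * θ) by ring, Real.cos_two_mul (2 * θ), Real.cos_two_mul]
    ring
  simp only [e]
  rw [intervalIntegral.integral_sub (Continuous.intervalIntegrable (by fun_prop) _ _)
    (Continuous.intervalIntegrable (by fun_prop) _ _), int_c4]
  simp

lemma rho_meas : Measurable rhoSC := by
  unfold rhoSC
  refine Measurable.ite (measurableSet_le (by fun_prop) (by fun_prop)) ?_ ?_ <;> fun_prop

lemma rho_int : Integrable rhoSC := by
  by_contra h
  have := mass
  rw [integral_undef h] at this
  norm_num at this

lemma sq_rho_int : Integrable (fun x => x ^ 2 * rhoSC x) := by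
  by_contra h
  have := second
  rw [integral_undef h] at this
  norm_num at this

lemma rho_bdd (x : ℝ) : ‖rhoSC x‖ ≤ 2 := by
  unfold rhoSC
  split_ifs
  · have h1 : Real.sqrt (4 - x ^ 2) ≤ 2 := by
      rw [Real.sqrt_le_left (by norm_num)]; nlinarith [sq_nonneg x]
    have h2 := Real.pi_gt_three
    rw [Real.norm_of_nonneg (by positivity), div_le_iff₀ (by positivity)]
    nlinarith
  · simp

lemma joint_int : Integrable (fun p : ℝ × ℝ => Real.log |p.1 - p.2| * rhoSC p.1 * rhoSC p.2) := by
  have hk : Integrable ((Set.Icc (-4 : ℝ) 4).indicator Real.log) := by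
    rw [integrable_indicator_iff measurableSet_Icc, integrableOn_Icc_iff_integrableOn_Ioc,
      ← intervalIntegrable_iff_integrableOn_Ioc_of_le (by norm_num)]
    exact intervalIntegral.intervalIntegrable_log'
  have h := rho_int.convolution_integrand (ContinuousLinearMap.mul ℝ ℝ) hk
  have h2 := h.bdd_mul (f := fun p : ℝ × ℝ => rhoSC p.1)
    (rho_meas.comp measurable_fst).aestronglyMeasurable
    (Filter.Eventually.of_forall fun p => rho_bdd p.1)
  refine h2.congr (Filter.Eventually.of_forall fun p => ?_)
  simp only [ContinuousLinearMap.mul_apply']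
  by_cases h1 : |p.1| ≤ 2
  · by_cases h3 : |p.2| ≤ 2
    · rw [abs_le] at h1 h3
      rw [Set.indicator_of_mem (by constructor <;> linarith), Real.log_abs]
      ring
    · simp [rhoSC, h3]
  · simp [rhoSC, h1]

theorem semicircle_log_energy :
    (1 / 2) * (∫ x : ℝ, x ^ 2 * rhoSC x)
      - ∫ p : ℝ × ℝ, Real.log |p.1 - p.2| * rhoSC p.1 * rhoSC p.2 = 3 / 4 := by
  have h : ∫ p : ℝ × ℝ, Real.log |p.1 - p.2| * rhoSC p.1 * rhoSC p.2 = -1 / 4 := by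
    rw [Measure.volume_eq_prod, integral_prod _ joint_int]
    have e : ∀ x, ∫ y, Real.log |x - y| * rhoSC x * rhoSC y
        = (1 / 4) * (x ^ 2 * rhoSC x) - (1 / 2) * rhoSC x := by
      intro x
      have : ∀ y, Real.log |x - y| * rhoSC x * rhoSC y
        = rhoSC x * (Real.log |x - y| * rhoSC y) := fun y => by ring
      simp only [this]
      rw [integral_const_mul]
      by_cases hx : |x| ≤ 2
      · rw [potential hx]; ring
      · simp [rhoSC, hx]
    simp only [e]
    rw [integral_sub (sq_rho_int.const_mul _) (rho_int.const_mul _), integral_const_mul,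
      integral_const_mul, second, mass]
    norm_num
  rw [h, second]
  norm_num
end

section
/- Helffer–Sjöstrand formula: let f ∈ C²_c(ℝ) and χ ∈ C¹_c(ℝ) with χ(y) = 1 for |y| ≤ 1/2. Then for every λ ∈ ℝ, f(λ) = (1/(2π)) ∫∫_{ℝ²} ( i y f''(x) χ(y) + i (f(x) + i y f'(x)) χ'(y) ) / (λ − x − i y) dx dy. -/
open MeasureTheory

open Set Filter Topology in
theorem hs_pompeiu (F : ℝ × ℝ → ℂ) (hF : ContDiff ℝ 1 F) (hc : HasCompactSupport F) :
    ∫ p : ℝ × ℝ, (fderiv ℝ F p (1, 0) + Complex.I * fderiv ℝ F p (0, 1)) /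
      (-((p.1 : ℂ) + Complex.I * (p.2 : ℂ))) = 2 * (Real.pi : ℂ) * F 0 := by
  set A : ℝ × ℝ → ℂ := fun p => fderiv ℝ F p (1, 0) with hA
  set B : ℝ × ℝ → ℂ := fun p => fderiv ℝ F p (0, 1) with hB
  have hD : Continuous (fderiv ℝ F) := hF.continuous_fderiv one_ne_zero
  have hAc : Continuous A := hD.clm_apply continuous_const
  have hBc : Continuous B := hD.clm_apply continuous_const
  have hlin : ∀ p (a b : ℝ), fderiv ℝ F p (a, b) = a * A p + b * B p := by
    intro p a b
    have : ((a, b) : ℝ × ℝ) = a • (1, 0) + b • (0, 1) := by simp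
    rw [this, map_add, map_smul, map_smul]
    simp [hA, hB]
  obtain ⟨R, hR⟩ := hc.isCompact.isBounded.subset_closedBall 0
  have hout : ∀ p : ℝ × ℝ, R < ‖p‖ → p ∉ tsupport F := by
    intro p hp h
    have := hR h
    simp at this
    linarith
  have hF0 : ∀ p : ℝ × ℝ, R < ‖p‖ → F p = 0 := fun p hp => image_eq_zero_of_notMem_tsupport (hout p hp)
  have hD0 : ∀ p : ℝ × ℝ, R < ‖p‖ → fderiv ℝ F p = 0 := fun p hp =>
    Function.notMem_support.1 (fun h => hout p hp (support_fderiv_subset ℝ h))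
  have hA0 : ∀ p : ℝ × ℝ, R < ‖p‖ → A p = 0 := fun p hp => by simp [hA, hD0 p hp]
  have hB0 : ∀ p : ℝ × ℝ, R < ‖p‖ → B p = 0 := fun p hp => by simp [hB, hD0 p hp]
  set P : ℝ × ℝ → ℝ × ℝ := fun q => (q.1 * Real.cos q.2, q.1 * Real.sin q.2) with hP
  have hPc : Continuous P := by fun_prop
  have hPn : ∀ q : ℝ × ℝ, 0 ≤ q.1 → 2 * R < q.1 → R < ‖P q‖ := by
    intro q h0 hq
    by_contra! h
    have h1 : |q.1 * Real.cos q.2| ≤ R := (norm_fst_le (P q)).trans h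
    have h2 : |q.1 * Real.sin q.2| ≤ R := (norm_snd_le (P q)).trans h
    have hR0 : 0 ≤ R := (abs_nonneg _).trans h1
    have h3 : (q.1 * Real.cos q.2)^2 ≤ R^2 := sq_le_sq' (abs_le.1 h1).1 (abs_le.1 h1).2
    have h4 : (q.1 * Real.sin q.2)^2 ≤ R^2 := sq_le_sq' (abs_le.1 h2).1 (abs_le.1 h2).2
    have h5 := Real.sin_sq_add_cos_sq q.2
    have h6 : q.1^2 = (q.1 * Real.cos q.2)^2 + (q.1 * Real.sin q.2)^2 := by
      linear_combination (-q.1^2) * h5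
    nlinarith
  set U : ℝ × ℝ → ℂ := fun q => (Real.cos q.2 : ℂ) * A (P q) + (Real.sin q.2 : ℂ) * B (P q) with hU
  set V : ℝ × ℝ → ℂ := fun q => ((-Real.sin q.2 : ℝ) : ℂ) * A (P q) + (Real.cos q.2 : ℂ) * B (P q) with hV
  have hUc : Continuous U := by
    have := hAc.comp hPc
    have := hBc.comp hPc
    simp only [Function.comp_def] at *
    fun_prop
  have hVc : Continuous V := by
    have := hAc.comp hPc
    have := hBc.comp hPc
    simp only [Function.comp_def] at *
    fun_prop
  have hintg : ∀ W : ℝ × ℝ → ℂ, Continuous W →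
      (∀ q : ℝ × ℝ, 0 ≤ q.1 → 2 * R < q.1 → W q = 0) →
      IntegrableOn W (Ioi (0:ℝ) ×ˢ Ioo (-Real.pi) Real.pi) := by
    intro W hW h0
    have hK : IntegrableOn W (Icc (0:ℝ) (2*R) ×ˢ Icc (-Real.pi) Real.pi) :=
      hW.continuousOn.integrableOn_compact (isCompact_Icc.prod isCompact_Icc)
    refine hK.of_forall_sdiff_eq_zero (measurableSet_Ioi.prod measurableSet_Ioo) ?_
    rintro ⟨r, t⟩ ⟨⟨h1, h2⟩, h3⟩
    simp only [mem_Ioi, mem_Ioo, mem_prod, mem_Icc] at h1 h2 h3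
    apply h0 _ h1.le
    by_contra! h
    exact h3 ⟨⟨h1.le, h⟩, h2.1.le, h2.2.le⟩
  have hU0 : ∀ q : ℝ × ℝ, 0 ≤ q.1 → 2 * R < q.1 → U q = 0 := fun q h h' => by
    simp [hU, hA0 _ (hPn q h h'), hB0 _ (hPn q h h')]
  have hV0 : ∀ q : ℝ × ℝ, 0 ≤ q.1 → 2 * R < q.1 → V q = 0 := fun q h h' => by
    simp [hV, hA0 _ (hPn q h h'), hB0 _ (hPn q h h')]
  have hUi := hintg U hUc hU0
  have hVi := hintg V hVc hV0
  have hFd : ∀ p, HasFDerivAt F (fderiv ℝ F p) p := fun p =>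
    ((hF.differentiable one_ne_zero) p).hasFDerivAt
  have hdr : ∀ t r : ℝ, HasDerivAt (fun r => F (P (r, t))) (U (r, t)) r := by
    intro t r
    have h1 : HasDerivAt (fun r : ℝ => P (r, t)) (Real.cos t, Real.sin t) r := by
      have a := (hasDerivAt_id r).mul_const (Real.cos t)
      have b := (hasDerivAt_id r).mul_const (Real.sin t)
      simpa [hP] using a.prodMk b
    have h2 := (hFd (P (r, t))).comp_hasDerivAt r h1
    rw [hlin] at h2
    exact h2
  have hdt : ∀ r t : ℝ, HasDerivAt (fun t => F (P (r, t))) (r * V (r, t)) t := by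
    intro r t
    have h1 : HasDerivAt (fun t : ℝ => P (r, t)) (r * (-Real.sin t), r * Real.cos t) t := by
      have a := (Real.hasDerivAt_cos t).const_mul r
      have b := (Real.hasDerivAt_sin t).const_mul r
      exact a.prodMk b
    have h2 := (hFd (P (r, t))).comp_hasDerivAt t h1
    rw [hlin] at h2
    refine h2.congr_deriv ?_
    simp only [hV]
    push_cast
    ring
  have hUr : ∀ t, ∫ r in Ioi (0:ℝ), U (r, t) = - F 0 := by
    intro t
    have hi : IntegrableOn (fun r => U (r, t)) (Ioi (0:ℝ)) := by
      have hK : IntegrableOn (fun r => U (r, t)) (Icc (0:ℝ) (2*R)) :=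
        (hUc.comp (by fun_prop : Continuous fun r : ℝ => (r, t))).continuousOn.integrableOn_compact
          isCompact_Icc
      refine hK.of_forall_sdiff_eq_zero measurableSet_Ioi ?_
      rintro r ⟨h1, h3⟩
      simp only [mem_Ioi, mem_Icc] at h1 h3
      apply hU0 _ h1.le
      by_contra! h
      exact h3 ⟨h1.le, h⟩
    have hlim : Tendsto (fun r => F (P (r, t))) atTop (𝓝 0) := by
      refine tendsto_const_nhds.congr' ?_
      filter_upwards [eventually_ge_atTop 0, eventually_gt_atTop (2*R)] with r h h'
      exact (hF0 _ (hPn _ h h')).symm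
    have := integral_Ioi_of_hasDerivAt_of_tendsto' (fun r _ => hdr t r) hi hlim
    rw [this]
    simp [hP]
    rfl
  have hVt : ∀ r ∈ Ioi (0:ℝ), ∫ t in Ioo (-Real.pi) Real.pi, V (r, t) = 0 := by
    intro r hr
    have hr' : (r:ℂ) ≠ 0 := by exact_mod_cast (ne_of_gt hr)
    have hVc' : Continuous fun t : ℝ => (r:ℂ) * V (r, t) :=
      continuous_const.mul (hVc.comp (by fun_prop : Continuous fun t : ℝ => (r, t)))
    have := intervalIntegral.integral_eq_sub_of_hasDerivAt (a := -Real.pi) (b := Real.pi)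
      (fun t _ => hdt r t) (hVc'.intervalIntegrable _ _)
    rw [intervalIntegral.integral_const_mul, intervalIntegral.integral_of_le
      (by linarith [Real.pi_pos]), integral_Ioc_eq_integral_Ioo] at this
    have h0 : F (P (r, Real.pi)) - F (P (r, -Real.pi)) = 0 := by simp [hP]
    rw [h0] at this
    exact (mul_eq_zero.1 this).resolve_left hr'
  have hUint : ∫ q in Ioi (0:ℝ) ×ˢ Ioo (-Real.pi) Real.pi, U q = - (2 * (Real.pi : ℂ) * F 0) := by
    have hUi' : Integrable U ((volume.restrict (Ioi (0:ℝ))).prod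
        (volume.restrict (Ioo (-Real.pi) Real.pi))) := by
      rw [Measure.prod_restrict]; exact hUi
    rw [Measure.volume_eq_prod, ← Measure.prod_restrict, integral_prod_symm _ hUi']
    simp only [hUr]
    have h2 : (Real.pi + Real.pi : ℝ) ≥ 0 := by linarith [Real.pi_pos]
    simp [Measure.real, ENNReal.toReal_ofReal h2]
    left
    ring
  have hVint : ∫ q in Ioi (0:ℝ) ×ˢ Ioo (-Real.pi) Real.pi, V q = 0 := by
    rw [Measure.volume_eq_prod, setIntegral_prod _ hVi]
    rw [setIntegral_congr_fun measurableSet_Ioi hVt]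
    simp
  rw [← integral_comp_polarCoord_symm]
  have hcongr : ∀ q ∈ polarCoord.target,
      q.1 • ((fderiv ℝ F (polarCoord.symm q) (1, 0) + Complex.I * fderiv ℝ F (polarCoord.symm q) (0, 1)) /
      (-(((polarCoord.symm q).1 : ℂ) + Complex.I * ((polarCoord.symm q).2 : ℂ))))
      = -(U q + Complex.I * V q) := by
    intro q hq
    have hr : 0 < q.1 := hq.1
    have hr' : (q.1:ℂ) ≠ 0 := by exact_mod_cast hr.ne'
    have hPq : polarCoord.symm q = P q := rfl
    rw [hPq]
    change q.1 • ((A (P q) + Complex.I * B (P q)) / _) = _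
    simp only [hU, hV]
    have h5 : (Real.sin q.2 : ℂ)^2 + (Real.cos q.2 : ℂ)^2 = 1 := by
      exact_mod_cast Real.sin_sq_add_cos_sq q.2
    have hP1 : (((P q).1 : ℝ) : ℂ) = q.1 * (Real.cos q.2 : ℂ) := by simp [hP]
    have hP2 : (((P q).2 : ℝ) : ℂ) = q.1 * (Real.sin q.2 : ℂ) := by simp [hP]
    rw [hP1, hP2, Complex.real_smul, Complex.ofReal_neg]
    generalize (Real.sin q.2 : ℂ) = s at *
    generalize (Real.cos q.2 : ℂ) = c at *
    have hI := Complex.I_sq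
    have hmul : (c + Complex.I * s) * (c - Complex.I * s) = 1 := by
      linear_combination h5 - s^2 * hI
    have hne : c + Complex.I * s ≠ 0 := left_ne_zero_of_mul_eq_one hmul
    have hne2 : -((q.1:ℂ) * c + Complex.I * (q.1 * s)) ≠ 0 := by
      have : -((q.1:ℂ) * c + Complex.I * (q.1 * s)) = -(q.1 * (c + Complex.I * s)) := by ring
      rw [this]
      exact neg_ne_zero.2 (mul_ne_zero hr' hne)
    rw [← mul_div_assoc, div_eq_iff hne2]
    linear_combination (-q.1 * (A (P q) + Complex.I * B (P q))) * hmul +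
      (-(q.1 * (c + Complex.I * s) * s * B (P q))) * hI
  rw [setIntegral_congr_fun polarCoord.open_target.measurableSet hcongr]
  have ht : polarCoord.target = Ioi (0:ℝ) ×ˢ Ioo (-Real.pi) Real.pi := rfl
  rw [ht, integral_neg, integral_add hUi (hVi.const_mul _), integral_const_mul, hUint, hVint]
  simp

theorem helffer_sjostrand (f : ℝ → ℂ) (hf : ContDiff ℝ 2 f) (hfc : HasCompactSupport f)
    (χ : ℝ → ℝ) (hχ : ContDiff ℝ 1 χ) (hχc : HasCompactSupport χ)
    (hχ1 : ∀ y : ℝ, |y| ≤ 1 / 2 → χ y = 1) (lam : ℝ) :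
    f lam = (1 / (2 * (Real.pi : ℂ))) *
      ∫ p : ℝ × ℝ,
        (Complex.I * (p.2 : ℂ) * deriv (deriv f) p.1 * (χ p.2 : ℂ) +
            Complex.I * (f p.1 + Complex.I * (p.2 : ℂ) * deriv f p.1) * ((deriv χ p.2 : ℝ) : ℂ)) /
          ((lam : ℂ) - (p.1 : ℂ) - Complex.I * (p.2 : ℂ)) := by
  have hf' : ContDiff ℝ 1 (deriv f) := by
    have : ContDiff ℝ (1 + 1) f := by simpa [one_add_one_eq_two] using hf
    exact (contDiff_succ_iff_deriv.1 this).2.2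
  have hf1 : ContDiff ℝ 1 f := hf.of_le (by norm_num)
  have hofr : ContDiff ℝ 1 (fun x : ℝ => (x : ℂ)) := Complex.ofRealCLM.contDiff
  set F : ℝ × ℝ → ℂ := fun p =>
    (f (p.1 + lam) + Complex.I * (p.2 : ℂ) * deriv f (p.1 + lam)) * (χ p.2 : ℂ) with hFdef
  have hF : ContDiff ℝ 1 F := by
    have h1 : ContDiff ℝ 1 fun p : ℝ × ℝ => f (p.1 + lam) :=
      hf1.comp (contDiff_fst.add contDiff_const)
    have h2 : ContDiff ℝ 1 fun p : ℝ × ℝ => deriv f (p.1 + lam) :=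
      hf'.comp (contDiff_fst.add contDiff_const)
    have h3 : ContDiff ℝ 1 fun p : ℝ × ℝ => (p.2 : ℂ) := hofr.comp contDiff_snd
    have h4 : ContDiff ℝ 1 fun p : ℝ × ℝ => (χ p.2 : ℂ) := hofr.comp (hχ.comp contDiff_snd)
    exact (h1.add ((contDiff_const.mul h3).mul h2)).mul h4
  have hc : HasCompactSupport F := by
    have hK : IsCompact (((fun x : ℝ => x + -lam) '' tsupport f) ×ˢ tsupport χ) :=
      (hfc.isCompact.image (by fun_prop)).prod hχc.isCompact
    refine HasCompactSupport.intro hK ?_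
    rintro ⟨x, y⟩ hxy
    by_cases hy : y ∈ tsupport χ
    · have hx : x + lam ∉ tsupport f := fun h => hxy ⟨⟨x + lam, h, by simp⟩, hy⟩
      have h1 : f (x + lam) = 0 := image_eq_zero_of_notMem_tsupport hx
      have h2 : deriv f (x + lam) = 0 :=
        Function.notMem_support.1 (fun h => hx (support_deriv_subset h))
      simp [hFdef, h1, h2]
    · simp [hFdef, image_eq_zero_of_notMem_tsupport hy]
  have hmain := hs_pompeiu F hF hc
  have hFd : ∀ p, HasFDerivAt F (fderiv ℝ F p) p := fun p =>
    ((hF.differentiable one_ne_zero) p).hasFDerivAt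
  have hA : ∀ p : ℝ × ℝ, fderiv ℝ F p (1, 0) =
      (deriv f (p.1 + lam) + Complex.I * (p.2 : ℂ) * deriv (deriv f) (p.1 + lam)) * (χ p.2 : ℂ) := by
    rintro ⟨x, y⟩
    have h1 : HasDerivAt (fun x : ℝ => ((x, y) : ℝ × ℝ)) (1, 0) x :=
      (hasDerivAt_id x).prodMk (hasDerivAt_const x y)
    have h2 := (hFd (x, y)).comp_hasDerivAt x h1
    have a := (((hf1.differentiable one_ne_zero) (x + lam)).hasDerivAt).comp_add_const x lam
    have b := (((hf'.differentiable one_ne_zero) (x + lam)).hasDerivAt).comp_add_const x lam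
    exact h2.unique ((a.add (b.const_mul (Complex.I * (y : ℂ)))).mul_const (χ y : ℂ))
  have hB : ∀ p : ℝ × ℝ, fderiv ℝ F p (0, 1) =
      Complex.I * deriv f (p.1 + lam) * (χ p.2 : ℂ) +
      (f (p.1 + lam) + Complex.I * (p.2 : ℂ) * deriv f (p.1 + lam)) * ((deriv χ p.2 : ℝ) : ℂ) := by
    rintro ⟨x, y⟩
    have h1 : HasDerivAt (fun y : ℝ => ((x, y) : ℝ × ℝ)) (0, 1) y :=
      (hasDerivAt_const y x).prodMk (hasDerivAt_id y)
    have h2 := (hFd (x, y)).comp_hasDerivAt y h1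
    have a := (((hχ.differentiable one_ne_zero) y).hasDerivAt).ofReal_comp
    have b : HasDerivAt (fun y : ℝ => (y : ℂ)) 1 y := Complex.ofRealCLM.hasDerivAt
    have c := (((b.const_mul Complex.I).mul_const (deriv f (x + lam))).const_add (f (x + lam))).mul a
    simpa using h2.unique c
  have hpi : (2 * (Real.pi : ℂ)) ≠ 0 := by simp [Real.pi_ne_zero]
  have hF0 : F 0 = f lam := by simp [hFdef, hχ1 0 (by norm_num)]
  rw [← integral_add_right_eq_self _ ((lam, 0) : ℝ × ℝ)]
  rw [hF0] at hmain
  have : f lam = (1 / (2 * (Real.pi : ℂ))) * (2 * (Real.pi : ℂ) * f lam) := by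
    field_simp
  rw [this, ← hmain]
  congr 1
  refine integral_congr_ae (Filter.Eventually.of_forall fun p => ?_)
  simp only [hA, hB, Prod.fst_add, Prod.snd_add, add_zero]
  congr 1
  · linear_combination (deriv f (p.1 + lam) * (χ p.2 : ℂ)) * Complex.I_sq
  · push_cast
    ring
end
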